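/- Let K be a field, δ ∈ ℕ, and g = Σ g_{ij} x^i y^j ∈ K[x,y] a nonzero polynomial with g(x,0) ≠ 0; set d_x^0 = deg g(x,0), b = deg_y g, and let G_δ be the δ-bihomogenization of g. If every (i,j) with g_{ij} ≠ 0 and j > 0 satisfies i < d_x^0 + δ·j, then G_δ(0, X1, Y0, Y1) = c·X1^{d_x^0}·Y0^{b}, where c is the (nonzero) coefficient of x^{d_x^0} in g(x,0); in particular, if b > 0, then for (y0,y1) ∈ K²\{(0,0)}, G_δ(0,1,y0,y1) = 0 holds exactly when y0 = 0. -/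

import Mathlib

open MvPolynomial

noncomputable section

variable {K : Type*} [Field K]

/-- With respect to the bigrading of `K[X0,X1,Y0,Y1]` in which `X0, X1` have
bidegree `(1,0)`, `Y0` has bidegree `(0,1)` and `Y1` has bidegree `(−δ,1)`
(variables `0 = X0`, `1 = X1`, `2 = Y0`, `3 = Y1`), the polynomial `G` is
bigraded homogeneous of bidegree `(d1, d2)`. -/
def IsBihomogeneous (δ : ℕ) (d1 d2 : ℤ) (G : MvPolynomial (Fin 4) K) : Prop :=
  ∀ m ∈ G.support, ((m 0 : ℤ) + (m 1 : ℤ) - (δ : ℤ) * (m 3 : ℤ) = d1) ∧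
    ((m 2 : ℤ) + (m 3 : ℤ) = d2)

/-- The exponent vector of the monomial of the `δ`-bihomogenization corresponding
to a monomial `x^i y^j` of `g` (where `i = m 0`, `j = m 1`), namely
`X0^(a−i+δj) · X1^i · Y0^(b−j) · Y1^j`, where `a = max {i' − δj'}` over the
support of `g` and `b = deg_y g`.  (The `X0`-exponent `a − i + δj` is computed
in `ℕ` as `(max_{m'} (i' + δj − δj')) − i`, which agrees with the integer value
since the maximum is attained at a nonnegative value `≥ i`.) -/
def bihomExp (δ : ℕ) (g : MvPolynomial (Fin 2) K) (m : Fin 2 →₀ ℕ) : Fin 4 →₀ ℕ :=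
  Finsupp.single 0 ((g.support.sup fun m' => m' 0 + δ * m 1 - δ * m' 1) - m 0) +
    Finsupp.single 1 (m 0) +
    Finsupp.single 2 ((g.support.sup fun m' => m' 1) - m 1) +
    Finsupp.single 3 (m 1)

/-- The `δ`-bihomogenization `G_δ = Σ g_{ij} X0^(a−i+δj) X1^i Y0^(b−j) Y1^j`
of a polynomial `g = Σ g_{ij} x^i y^j ∈ K[x,y]`. -/
def bihom (δ : ℕ) (g : MvPolynomial (Fin 2) K) : MvPolynomial (Fin 4) K :=
  ∑ m ∈ g.support, monomial (bihomExp δ g m) (coeff m g)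

/-- The coefficients of `g(x, 0)` are the coefficients of `g` at the pure powers of `x`. -/
lemma coeff_aeval_X_zero (g : MvPolynomial (Fin 2) K) (n : ℕ) :
    (aeval ![(Polynomial.X : Polynomial K), 0] g).coeff n = coeff (Finsupp.single 0 n) g := by
  induction g using MvPolynomial.induction_on' with
  | monomial m a =>
    rw [aeval_monomial, coeff_monomial, Finsupp.prod_fintype _ _ (by simp), Fin.prod_univ_two]
    have hm : m = Finsupp.single 0 n ↔ n = m 0 ∧ m 1 = 0 := by
      rw [Finsupp.ext_iff, Fin.forall_fin_two]
      simp [eq_comm]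
    rw [if_congr hm rfl rfl]
    by_cases h1 : m 1 = 0
    · simp [h1, Polynomial.algebraMap_eq, Polynomial.coeff_C_mul, Polynomial.coeff_X_pow]
    · simp [h1]
  | add p q hp hq => simp [hp, hq]

/-- If all monomials `x^i y^j` of `g` other than `x^d` satisfy `i < d + δ j`, then setting
`X0 = 0` in the `δ`-bihomogenization leaves only the term coming from `x^d`. -/
lemma aeval_bihom_of_zero {A : Type*} [CommRing A] [Algebra K A] (δ : ℕ)
    (g : MvPolynomial (Fin 2) K) (d : ℕ) (hd : Finsupp.single 0 d ∈ g.support)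
    (hlt : ∀ m ∈ g.support, m ≠ Finsupp.single 0 d → m 0 < d + δ * m 1)
    (v : Fin 4 → A) (hv : v 0 = 0) :
    aeval v (bihom δ g) =
      algebraMap K A (coeff (Finsupp.single 0 d) g) * v 1 ^ d * v 2 ^ g.degreeOf 1 := by
  have hterm : ∀ m : Fin 2 →₀ ℕ, aeval v (monomial (bihomExp δ g m) (coeff m g)) =
      algebraMap K A (coeff m g) *
        (0 ^ ((g.support.sup fun m' => m' 0 + δ * m 1 - δ * m' 1) - m 0) * v 1 ^ m 0 *
          v 2 ^ (g.degreeOf 1 - m 1) * v 3 ^ m 1) := by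
    intro m
    rw [aeval_monomial, Finsupp.prod_fintype _ _ (by simp), Fin.prod_univ_four, hv,
      degreeOf_eq_sup]
    simp [bihomExp]
  rw [bihom, map_sum, Finset.sum_eq_single_of_mem _ hd]
  · have hsup : (g.support.sup fun m' => m' 0 + δ * (Finsupp.single 0 d : Fin 2 →₀ ℕ) 1 -
        δ * m' 1) ≤ d := by
      refine Finset.sup_le fun m hm => ?_
      by_cases h : m = Finsupp.single 0 d
      · simp [h]
      · have := hlt m hm h
        simp
        omega
    have h0 : (g.support.sup fun m' => m' 0 + δ * (Finsupp.single 0 d : Fin 2 →₀ ℕ) 1 -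
        δ * m' 1) - (Finsupp.single 0 d : Fin 2 →₀ ℕ) 0 = 0 := by
      rw [Finsupp.single_eq_same]
      exact Nat.sub_eq_zero_of_le hsup
    rw [hterm, h0]
    simp [mul_assoc]
  · intro m hm h
    have hle := Finset.le_sup (f := fun m' => m' 0 + δ * m 1 - δ * m' 1) hd
    have hm0 := hlt m hm h
    simp only [Finsupp.single_eq_same, Finsupp.single_apply, zero_ne_one, if_false, mul_zero,
      Nat.sub_zero] at hle
    rw [hterm, zero_pow (Nat.sub_ne_zero_of_lt (hm0.trans_le hle))]
    simp

/-- **Case 3 in the proof of Theorem 4.2.** For `g ≠ 0` with `g(x,0) ≠ 0`,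
`d_x^0 = deg g(x,0)` and `b = deg_y g`: if every `(i,j)` in the support of `g`
with `j > 0` satisfies `i < d_x^0 + δ·j`, then
`G_δ(0,X1,Y0,Y1) = c·X1^{d_x^0}·Y0^b`, where `c` is the (nonzero) coefficient of
`x^{d_x^0}` in `g(x,0)`; in particular, if `b > 0`, then for
`(y0,y1) ≠ (0,0)` one has `G_δ(0,1,y0,y1) = 0` exactly when `y0 = 0`. -/
theorem bihom_eval_X0_zero (δ : ℕ) (g : MvPolynomial (Fin 2) K) (hg : g ≠ 0)
    (hgx : aeval ![(Polynomial.X : Polynomial K), 0] g ≠ 0)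
    (d : ℕ) (hd : d = (aeval ![(Polynomial.X : Polynomial K), 0] g).natDegree)
    (b : ℕ) (hb : b = g.degreeOf 1)
    (hlt : ∀ m ∈ g.support, 0 < m 1 → m 0 < d + δ * m 1) :
    ((aeval ![(Polynomial.X : Polynomial K), 0] g).coeff d ≠ 0 ∧
      aeval ![0, X 1, X 2, X 3] (bihom δ g) =
        (C ((aeval ![(Polynomial.X : Polynomial K), 0] g).coeff d) *
          X 1 ^ d * X 2 ^ b : MvPolynomial (Fin 4) K)) ∧
    (0 < b → ∀ y0 y1 : K, ¬ (y0 = 0 ∧ y1 = 0) →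
      (MvPolynomial.eval ![(0 : K), 1, y0, y1] (bihom δ g) = 0 ↔ y0 = 0)) := by
  subst hd hb
  set p := aeval ![(Polynomial.X : Polynomial K), 0] g
  have hc : p.coeff p.natDegree ≠ 0 := Polynomial.leadingCoeff_ne_zero.mpr hgx
  have hcoeff : ∀ n, p.coeff n = coeff (Finsupp.single 0 n) g := coeff_aeval_X_zero g
  have hmem : Finsupp.single 0 p.natDegree ∈ g.support := by
    rwa [mem_support_iff, ← hcoeff]
  have hlt' : ∀ m ∈ g.support, m ≠ Finsupp.single 0 p.natDegree →
      m 0 < p.natDegree + δ * m 1 := by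
    intro m hm hne
    rcases Nat.eq_zero_or_pos (m 1) with h1 | h1
    · have hm' : m = Finsupp.single 0 (m 0) := by
        rw [Finsupp.ext_iff, Fin.forall_fin_two]
        simp [h1]
      have hle : m 0 ≤ p.natDegree := by
        apply Polynomial.le_natDegree_of_ne_zero
        rwa [hcoeff, ← hm', ← mem_support_iff]
      have hne' : m 0 ≠ p.natDegree := fun h => hne (h ▸ hm')
      omega
    · exact hlt m hm h1
  refine ⟨⟨hc, ?_⟩, fun hb y0 y1 _ => ?_⟩
  · rw [aeval_bihom_of_zero δ g _ hmem hlt' _ rfl, hcoeff]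
    simp [algebraMap_eq]
  · rw [← coe_aeval_eq_eval, RingHom.coe_coe,
      aeval_bihom_of_zero δ g _ hmem hlt' _ rfl, ← hcoeff]
    simp only [Polynomial.coeff_natDegree] at hc
    simp [hgx, hb.ne']

end
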